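/- arXiv:2209.10012 — 2 statements merged into one kernel-verified Lean document; each statement's English description precedes it below -/
import Mathlib

section
/- For all positive integers D and N, there exists a corner-free subset A ⊆ [N]² with |A| ≥ c·√D·(3/4)^D·N^{2−2/D}, where c > 0 is an absolute constant independent of D and N. -/
/-- A set of lattice points is corner-free if it contains no triple
`(x,y), (x+d,y), (x,y+d)` with `d ≠ 0`. -/
def CornerFree (A : Set (ℤ × ℤ)) : Prop :=
  ¬ ∃ x y d : ℤ, d ≠ 0 ∧ (x, y) ∈ A ∧ (x + d, y) ∈ A ∧ (x, y + d) ∈ A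

open MeasureTheory Set

/-- The representative in `(0, 1]` of a point of the unit circle. -/
noncomputable def circleRep (t : UnitAddCircle) : ℝ := AddCircle.equivIoc 1 0 t

theorem circleRep_mem (t : UnitAddCircle) : circleRep t ∈ Ioc (0 : ℝ) 1 := by
  simpa [circleRep] using (AddCircle.equivIoc 1 0 t).2

theorem coe_circleRep (t : UnitAddCircle) : (circleRep t : UnitAddCircle) = t :=
  (AddCircle.equivIoc 1 0).symm_apply_apply t

theorem circleRep_coe {x : ℝ} (hx : x ∈ Ioc (0 : ℝ) 1) : circleRep (x : UnitAddCircle) = x := by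
  have hx' : x ∈ Ioc (0 : ℝ) (0 + 1) := by simpa using hx
  simp [circleRep, AddCircle.equivIoc_coe_eq hx']

theorem measurable_circleRep : Measurable circleRep :=
  measurable_subtype_coe.comp (AddCircle.measurableEquivIoc 1 0).measurable

theorem norm_le_abs_circleRep_sub (a t : UnitAddCircle) :
    ‖t‖ ≤ |circleRep (a + t) - circleRep a| := by
  have h : ((circleRep (a + t) - circleRep a : ℝ) : UnitAddCircle) = t := by
    rw [AddCircle.coe_sub, coe_circleRep, coe_circleRep]; abel
  calc ‖t‖ = ‖((circleRep (a + t) - circleRep a : ℝ) : UnitAddCircle)‖ := by rw [h]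
    _ ≤ _ := by
      rw [← Real.norm_eq_abs]; exact QuotientAddGroup.norm_mk_le_norm

/-- The strip `1/2 ≤ a + b < 3/2` in the two-dimensional torus. -/
def torusStrip : Set (UnitAddCircle × UnitAddCircle) :=
  {z | circleRep z.1 + circleRep z.2 ∈ Ico (1 / 2 : ℝ) (3 / 2)}

theorem measurableSet_torusStrip : MeasurableSet torusStrip :=
  measurableSet_Ico.preimage ((measurable_circleRep.comp measurable_fst).add
    (measurable_circleRep.comp measurable_snd))

/-- A corner of the torus inside the strip lifts to a corner of the plane. -/
theorem circleRep_sub_eq_of_mem_torusStrip {a b t : UnitAddCircle}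
    (h₁ : (a + t, b) ∈ torusStrip) (h₂ : (a, b + t) ∈ torusStrip) :
    circleRep (a + t) - circleRep a = circleRep (b + t) - circleRep b := by
  have h : ((circleRep (a + t) - circleRep a - (circleRep (b + t) - circleRep b) : ℝ) :
      UnitAddCircle) = 0 := by
    simp only [AddCircle.coe_sub, coe_circleRep]; abel
  obtain ⟨n, hn⟩ := (AddCircle.coe_eq_zero_iff 1).1 h
  simp only [torusStrip, mem_ofPred_eq, mem_Ico] at h₁ h₂
  simp only [zsmul_eq_mul, mul_one] at hn
  have hn1 : (n : ℝ) < 1 := by linarith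
  have hn2 : (-1 : ℝ) < n := by linarith
  have : n = 0 := by
    have h1 : n < 1 := by exact_mod_cast hn1
    have h2 : -1 < n := by exact_mod_cast hn2
    omega
  rw [this] at hn
  push_cast at hn
  linarith

theorem volume_torusStrip_slice (x : ℝ) (hx : x ∈ Ioc (0 : ℝ) 1) :
    ENNReal.ofReal (1 - |x - 1 / 2|) ≤
      volume (Prod.mk (x : UnitAddCircle) ⁻¹' torusStrip) := by
  rw [AddCircle.add_projection_respects_measure 1 0
    (measurable_prodMk_left measurableSet_torusStrip)]
  have : Ioo (max 0 (1 / 2 - x)) (min 1 (3 / 2 - x)) ⊆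
      QuotientAddGroup.mk ⁻¹' (Prod.mk (x : UnitAddCircle) ⁻¹' torusStrip) ∩ Ioc (0 : ℝ) (0 + 1) := by
    intro y hy
    simp only [mem_Ioo, max_lt_iff, lt_min_iff] at hy
    have hy' : y ∈ Ioc (0 : ℝ) 1 := ⟨hy.1.1, hy.2.1.le⟩
    refine ⟨?_, by simpa using hy'⟩
    have h1 := circleRep_coe hx
    have h2 := circleRep_coe hy'
    change circleRep (x : UnitAddCircle) + circleRep (y : UnitAddCircle) ∈ Ico (1 / 2 : ℝ) (3 / 2)
    rw [h1, h2]
    constructor <;> linarith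
  refine le_trans ?_ (measure_mono this)
  rw [Real.volume_Ioo]
  apply ENNReal.ofReal_le_ofReal
  obtain ⟨h0, h1⟩ := hx
  rcases le_total x (1 / 2) with h | h
  · rw [abs_of_nonpos (by linarith), max_eq_right (by linarith), min_eq_left (by linarith)]
    linarith
  · rw [abs_of_nonneg (by linarith), max_eq_left (by linarith), min_eq_right (by linarith)]
    linarith

theorem integral_one_sub_abs_sub_half : ∫ x in (0 : ℝ)..1, (1 - |x - 1 / 2|) = 3 / 4 := by
  have hc : Continuous fun x : ℝ => 1 - |x - 1 / 2| := by fun_prop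
  rw [← intervalIntegral.integral_add_adjacent_intervals (b := 1 / 2)
    (hc.intervalIntegrable _ _) (hc.intervalIntegrable _ _)]
  have e1 : ∫ x in (0 : ℝ)..(1 / 2), (1 - |x - 1 / 2|) = ∫ x in (0 : ℝ)..(1 / 2), (1 / 2 + x) := by
    apply intervalIntegral.integral_congr
    intro x hx
    rw [uIcc_of_le (by norm_num)] at hx
    simp only
    rw [abs_of_nonpos (by linarith [hx.2])]; ring
  have e2 : ∫ x in (1 / 2 : ℝ)..1, (1 - |x - 1 / 2|) = ∫ x in (1 / 2 : ℝ)..1, (3 / 2 - x) := by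
    apply intervalIntegral.integral_congr
    intro x hx
    rw [uIcc_of_le (by norm_num)] at hx
    simp only
    rw [abs_of_nonneg (by linarith [hx.1])]; ring
  rw [e1, e2, intervalIntegral.integral_add (by simp) (by simp),
    intervalIntegral.integral_sub (by simp) (by simp)]
  simp only [intervalIntegral.integral_const, integral_id, smul_eq_mul]
  norm_num

theorem three_quarters_le_volume_torusStrip : ENNReal.ofReal (3 / 4) ≤ volume torusStrip := by
  rw [Measure.volume_eq_prod, Measure.prod_apply measurableSet_torusStrip,
    ← UnitAddCircle.lintegral_preimage 0, zero_add, ← integral_one_sub_abs_sub_half,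
    intervalIntegral.integral_of_le zero_le_one, ofReal_integral_eq_lintegral_ofReal]
  · exact setLIntegral_mono' measurableSet_Ioc volume_torusStrip_slice
  · exact ((by fun_prop : Continuous fun x : ℝ => 1 - |x - 1 / 2|).intervalIntegrable 0 1).1
  · refine (ae_restrict_iff' measurableSet_Ioc).2 (.of_forall fun x hx => ?_)
    have : |x - 1 / 2| ≤ 1 := abs_le.2 ⟨by linarith [hx.1], by linarith [hx.2]⟩
    simpa using this

instance : IsProbabilityMeasure (volume : Measure UnitAddCircle) := ⟨UnitAddCircle.measure_univ⟩

instance : (volume : Measure (UnitAddCircle × UnitAddCircle)).IsAddLeftInvariant :=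
  Measure.prod.instIsAddLeftInvariant

theorem integral_exp_neg_mul_norm_sq_le {l : ℝ} (hl : 0 < l) :
    ∫ t : UnitAddCircle, Real.exp (-l * ‖t‖ ^ 2) ≤ √(Real.pi / l) := by
  rw [← UnitAddCircle.integral_preimage (-(1 / 2)), ← integral_gaussian l]
  have h : ∫ a in Ioc (-(1 / 2 : ℝ)) (-(1 / 2) + 1), Real.exp (-l * ‖(a : UnitAddCircle)‖ ^ 2) =
      ∫ a in Ioc (-(1 / 2 : ℝ)) (-(1 / 2) + 1), Real.exp (-l * a ^ 2) := by
    refine setIntegral_congr_fun measurableSet_Ioc fun a ha => ?_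
    have ha' : |a| ≤ |(1 : ℝ)| / 2 := by
      rw [abs_one]; exact abs_le.2 ⟨by linarith [ha.1], by linarith [ha.2]⟩
    rw [(AddCircle.norm_coe_eq_abs_iff 1 one_ne_zero).2 ha', sq_abs]
  rw [h]
  exact setIntegral_le_integral (integrable_exp_neg_mul_sq hl)
    (.of_forall fun x => (Real.exp_pos _).le)

/-- A Chernoff bound for the volume of a small Euclidean ball in the torus. -/
theorem volume_torus_ball_le {D : ℕ} (hD : 1 ≤ D) {δ r : ℝ} (hδ : 0 < δ) (hr : 0 ≤ r)
    (h : 20 * δ ≤ D * r ^ 2) :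
    volume.real {t : Fin D → UnitAddCircle | ∑ i, ‖t i‖ ^ 2 ≤ δ} ≤ r ^ D := by
  have hD' : (0 : ℝ) < D := by exact_mod_cast hD
  set l : ℝ := D / (2 * δ) with hl
  have hl0 : 0 < l := by positivity
  set f : (Fin D → UnitAddCircle) → ℝ := fun t => ∏ i, Real.exp (-l * ‖t i‖ ^ 2) with hf
  have hfc : Continuous f := by fun_prop
  have hint : ∫ t, f t ≤ √(Real.pi / l) ^ D := by
    rw [hf, integral_fintype_prod_volume_eq_prod
      (f := fun (_ : Fin D) (t : UnitAddCircle) => Real.exp (-l * ‖t‖ ^ 2))]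
    simp only [Finset.prod_const, Finset.card_univ, Fintype.card_fin]
    exact pow_le_pow_left₀ (integral_nonneg fun _ => (Real.exp_pos _).le)
      (integral_exp_neg_mul_norm_sq_le hl0) _
  have hmarkov := mul_meas_ge_le_integral_of_nonneg (μ := volume) (f := f)
    (.of_forall fun t => Finset.prod_nonneg fun _ _ => (Real.exp_pos _).le)
    (hfc.integrable_of_hasCompactSupport (HasCompactSupport.of_compactSpace f))
    (Real.exp (-l * δ))
  have hset : {t : Fin D → UnitAddCircle | Real.exp (-l * δ) ≤ f t} =
      {t | ∑ i, ‖t i‖ ^ 2 ≤ δ} := by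
    ext t
    simp only [mem_ofPred_eq, hf, ← Real.exp_sum, ← Finset.mul_sum, Real.exp_le_exp]
    constructor <;> intro h <;> nlinarith
  rw [hset] at hmarkov
  have hexp : Real.exp (-l * δ) = (Real.exp (-(1 / 2))) ^ D := by
    rw [← Real.exp_nat_mul]; congr 1; rw [hl]; field_simp
  have hbase : √(Real.pi / l) ≤ Real.exp (-(1 / 2)) * r := by
    refine Real.sqrt_le_iff.2 ⟨by positivity, ?_⟩
    have he : Real.exp (-(1 / 2)) ^ 2 * Real.exp 1 = 1 := by
      rw [← Real.exp_nat_mul, ← Real.exp_add]; norm_num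
    have he1 : Real.exp 1 < 2.72 := Real.exp_one_lt_d9.trans (by norm_num)
    have hpi : Real.pi < 3.15 := Real.pi_lt_d2
    have hE : 20 / 55 ≤ Real.exp (-(1 / 2)) ^ 2 := by
      by_contra! hlt
      nlinarith [Real.exp_pos 1, sq_nonneg (Real.exp (-(1 / 2)))]
    calc Real.pi / l = 2 * Real.pi * δ / D := by rw [hl]; field_simp
      _ ≤ 20 / 55 * r ^ 2 := by
        rw [div_le_iff₀ hD']
        nlinarith
      _ ≤ Real.exp (-(1 / 2)) ^ 2 * r ^ 2 := by gcongr
      _ = _ := by ring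
  have hpos : 0 < Real.exp (-(1 / 2)) ^ D := by positivity
  refine le_of_mul_le_mul_left ?_ hpos
  calc _ ≤ ∫ t, f t := by rw [← hexp]; exact hmarkov
    _ ≤ √(Real.pi / l) ^ D := hint
    _ ≤ (Real.exp (-(1 / 2)) * r) ^ D := by gcongr
    _ = _ := mul_pow _ _ _

/-- There is a rotation of the torus none of whose first multiples is close to the origin. -/
theorem exists_rotation_avoiding_ball {D N : ℕ} {δ : ℝ}
    (h : N * volume.real {t : Fin D → UnitAddCircle | ∑ i, ‖t i‖ ^ 2 ≤ δ} < 1) :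
    ∃ θ : Fin D → UnitAddCircle, ∀ d : ℤ, 1 ≤ d → d ≤ N → δ < ∑ i, ‖d • θ i‖ ^ 2 := by
  set B : Set (Fin D → UnitAddCircle) := {t | ∑ i, ‖t i‖ ^ 2 ≤ δ} with hB
  have hBm : MeasurableSet B := (isClosed_le (by fun_prop) continuous_const).measurableSet
  have hpre : ∀ d : ℤ, 1 ≤ d →
      volume.real ((fun θ : Fin D → UnitAddCircle => d • θ) ⁻¹' B) = volume.real B := fun d hd => by
    rw [measureReal_def, (Measure.measurePreserving_zsmul volume (by omega)).measure_preimage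
      hBm.nullMeasurableSet, measureReal_def]
  have hU : volume.real (⋃ d ∈ Finset.Icc (1 : ℤ) N,
      (fun θ : Fin D → UnitAddCircle => d • θ) ⁻¹' B) < 1 := by
    refine lt_of_le_of_lt (measureReal_biUnion_finset_le _ _) ?_
    rw [Finset.sum_congr rfl fun d hd => hpre d (Finset.mem_Icc.1 hd).1]
    simpa using h
  by_contra! hcon
  have : (⋃ d ∈ Finset.Icc (1 : ℤ) N, (fun θ : Fin D → UnitAddCircle => d • θ) ⁻¹' B) = univ := by
    refine eq_univ_of_forall fun θ => ?_
    obtain ⟨d, h1, h2, h3⟩ := hcon θ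
    simp only [mem_iUnion]
    exact ⟨d, Finset.mem_Icc.2 ⟨h1, h2⟩, h3⟩
  rw [this] at hU
  simp at hU

/-- Some translate of a finite configuration meets a set in at least the average proportion. -/
theorem exists_translate_card_ge {G ι : Type*} [AddGroup G] [MeasurableSpace G] [MeasurableAdd G]
    (μ : Measure G) [IsProbabilityMeasure μ] [μ.IsAddLeftInvariant] {E : Set G}
    (hE : MeasurableSet E) (s : Finset ι) (p : ι → G) [∀ ω, DecidablePred fun i => p i + ω ∈ E] :
    ∃ ω, s.card * μ.real E ≤ (s.filter fun i => p i + ω ∈ E).card := by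
  have hm : ∀ i, MeasurableSet ((fun ω => p i + ω) ⁻¹' E) := fun i => measurable_const_add (p i) hE
  have hint : ∀ i ∈ s, Integrable (((fun ω => p i + ω) ⁻¹' E).indicator (1 : G → ℝ)) μ :=
    fun i _ => (integrable_const 1).indicator (hm i)
  obtain ⟨ω, hω⟩ := exists_integral_le (integrable_finsetSum s hint)
  refine ⟨ω, ?_⟩
  rw [integral_finsetSum s hint] at hω
  simp only [integral_indicator_one (hm _), measureReal_def, measure_preimage_add] at hω
  have hcard : ∑ i ∈ s, ((fun ω => p i + ω) ⁻¹' E).indicator (1 : G → ℝ) ω =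
      (s.filter fun i => p i + ω ∈ E).card := by
    rw [Finset.card_filter, Nat.cast_sum]
    refine Finset.sum_congr rfl fun i _ => ?_
    by_cases h : p i + ω ∈ E <;> simp [indicator, h]
  rw [hcard] at hω
  simpa [measureReal_def] using hω

open ProbabilityTheory in
/-- A sum of `D` independent variables with values in `[0, 1]` lies in some window of length `δ`
with probability at least a constant multiple of `δ / √D`. -/
theorem exists_window_pi {Ω : Type*} [MeasurableSpace Ω] (ν : Measure Ω) [IsProbabilityMeasure ν]
    {g : Ω → ℝ} (hg : Measurable g) (hg01 : ∀ z, g z ∈ Icc (0 : ℝ) 1) {D : ℕ} (hD : 1 ≤ D)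
    {δ : ℝ} (hδ : 0 < δ) (hδD : δ ≤ √D) :
    ∃ r : ℝ, δ / (6 * √D) ≤
      (Measure.pi fun _ : Fin D => ν).real {z | ∑ i, g (z i) ∈ Ico r (r + δ)} := by
  set P := Measure.pi fun _ : Fin D => ν with hP
  have hD' : (0 : ℝ) < D := by exact_mod_cast hD
  have hs : 0 < √(D : ℝ) := Real.sqrt_pos.2 hD'
  have hgL : MemLp g 2 ν := memLp_of_bounded (.of_forall hg01) hg.aestronglyMeasurable 2
  set F : (Fin D → Ω) → ℝ := fun z => ∑ i, g (z i) with hF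
  have hFeq : F = ∑ i : Fin D, fun z : Fin D → Ω => g (z i) := by
    ext z; simp [hF]
  have hFm : Measurable F := by fun_prop
  have hFL : MemLp F 2 P := by
    rw [hFeq]
    exact memLp_finsetSum' _ fun i _ => hgL.comp_measurePreserving (measurePreserving_eval _ i)
  have hvar : Var[F; P] ≤ D / 4 := by
    rw [hFeq, hP, variance_sum_pi (μ := fun _ : Fin D => ν) (X := fun _ => g) fun _ => hgL]
    have := variance_le_sq_of_bounded (μ := ν) (.of_forall hg01) hg.aemeasurable
    simp only [Finset.sum_const, Finset.card_univ, Fintype.card_fin, nsmul_eq_mul]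
    nlinarith
  set m := ∫ z, F z ∂P with hm
  have htail : P.real {z | √D ≤ |F z - m|} ≤ 1 / 4 := by
    have h1 := meas_ge_le_variance_div_sq hFL hs
    have h2 : Var[F; P] / √D ^ 2 ≤ 1 / 4 := by
      rw [Real.sq_sqrt hD'.le, div_le_iff₀ hD']; linarith
    exact ENNReal.toReal_le_of_le_ofReal (by norm_num)
      (h1.trans (ENNReal.ofReal_le_ofReal h2))
  set K := ⌈2 * √D / δ⌉₊ with hK
  have hK1 : 2 * √D / δ ≤ K := Nat.le_ceil _
  have hK2 : K ≤ 3 * √D / δ := by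
    have h1 := (Nat.ceil_lt_add_one (by positivity : 0 ≤ 2 * √D / δ)).le
    have h2 : 1 ≤ √D / δ := (one_le_div hδ).2 hδD
    calc (K : ℝ) ≤ 2 * √D / δ + 1 := h1
      _ ≤ 2 * √D / δ + √D / δ := by linarith
      _ = _ := by ring
  by_contra! hcon
  have hcover : (univ : Set (Fin D → Ω)) ⊆ {z | √D ≤ |F z - m|} ∪
      ⋃ j ∈ Finset.range K, {z | F z ∈ Ico (m - √D + j * δ) (m - √D + j * δ + δ)} := by
    intro z _
    by_cases hz : √D ≤ |F z - m|
    · exact Or.inl hz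
    right
    obtain ⟨hz1, hz2⟩ := abs_lt.1 (not_le.1 hz)
    have hnn : 0 ≤ (F z - (m - √D)) / δ := div_nonneg (by linarith) hδ.le
    have hj1 := Nat.floor_le hnn
    have hj2 := Nat.lt_floor_add_one ((F z - (m - √D)) / δ)
    simp only [mem_iUnion, Finset.mem_range]
    refine ⟨⌊(F z - (m - √D)) / δ⌋₊, ?_, ?_, ?_⟩
    · have : (F z - (m - √D)) / δ < 2 * √D / δ := by gcongr; linarith
      exact_mod_cast hj1.trans_lt (this.trans_le hK1)
    · rw [le_div_iff₀ hδ] at hj1; linarith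
    · rw [div_lt_iff₀ hδ] at hj2; linarith
  have hsum : P.real (⋃ j ∈ Finset.range K,
      {z | F z ∈ Ico (m - √D + j * δ) (m - √D + j * δ + δ)}) ≤ 1 / 2 := by
    refine (measureReal_biUnion_finset_le _ _).trans ?_
    calc _ ≤ ∑ j ∈ Finset.range K, δ / (6 * √D) := Finset.sum_le_sum fun j _ => (hcon _).le
      _ = K * (δ / (6 * √D)) := by simp
      _ ≤ 3 * √D / δ * (δ / (6 * √D)) := by gcongr
      _ = 1 / 2 := by field_simp; norm_num
  have h1 : P.real univ ≤ 1 / 4 + 1 / 2 :=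
    (measureReal_mono hcover).trans ((measureReal_union_le _ _).trans (add_le_add htail hsum))
  simp at h1
  norm_num at h1

open ProbabilityTheory in
/-- The product of conditioned measures is the rescaled restriction to the product set. -/
theorem measureReal_inter_univ_pi {Ω : Type*} [MeasurableSpace Ω] (μ : Measure Ω)
    [IsFiniteMeasure μ] {S : Set Ω} (hS : MeasurableSet S) (hS0 : μ S ≠ 0) (D : ℕ)
    (E : Set (Fin D → Ω)) :
    (Measure.pi fun _ : Fin D => μ).real (E ∩ univ.pi fun _ => S) =
      μ.real S ^ D * (Measure.pi fun _ : Fin D => μ[|S]).real E := by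
  have key : Measure.pi (fun _ : Fin D => μ.restrict S) =
      (μ S ^ D) • Measure.pi fun _ : Fin D => μ[|S] := by
    have := cond_isProbabilityMeasure hS0
    refine Measure.pi_eq fun s hs => ?_
    rw [Measure.smul_apply, Measure.pi_pi, smul_eq_mul]
    have : ∀ i, μ.restrict S (s i) = μ S * μ[|S] (s i) := fun i => by
      rw [Measure.restrict_apply (hs i), cond_apply hS, ← mul_assoc,
        ENNReal.mul_inv_cancel hS0 (measure_ne_top _ _), one_mul, inter_comm]
    simp only [this, Finset.prod_mul_distrib, Finset.prod_const, Finset.card_univ,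
      Fintype.card_fin]
  have h := congrArg (fun m => m E) key
  simp only [← Measure.restrict_pi_pi, Measure.smul_apply, smul_eq_mul] at h
  rw [Measure.restrict_apply' (MeasurableSet.univ_pi fun _ => hS)] at h
  simp only [measureReal_def, h, ENNReal.toReal_mul, ENNReal.toReal_pow]

/-- The points of the torus whose coordinates lie in the strip and whose vector of differences has
squared length in the window `[r, r + δ)`. -/
def stripAnnulus (D : ℕ) (r δ : ℝ) : Set (Fin D → UnitAddCircle × UnitAddCircle) :=
  {z | ∑ i, (circleRep (z i).1 - circleRep (z i).2) ^ 2 ∈ Ico r (r + δ)} ∩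
    univ.pi fun _ => torusStrip

theorem measurableSet_stripAnnulus (D : ℕ) (r δ : ℝ) : MeasurableSet (stripAnnulus D r δ) := by
  refine MeasurableSet.inter (measurableSet_Ico.preimage ?_)
    (MeasurableSet.univ_pi fun _ => measurableSet_torusStrip)
  have := measurable_circleRep
  fun_prop

theorem exists_volume_stripAnnulus_ge {D : ℕ} (hD : 1 ≤ D) {δ : ℝ} (hδ : 0 < δ) (hδD : δ ≤ √D) :
    ∃ r : ℝ, (3 / 4) ^ D * (δ / (6 * √D)) ≤ volume.real (stripAnnulus D r δ) := by
  have h34 := three_quarters_le_volume_torusStrip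
  have hS0 : volume torusStrip ≠ 0 :=
    ((ENNReal.ofReal_pos.2 (by norm_num)).trans_le h34).ne'
  have hS : 3 / 4 ≤ volume.real torusStrip :=
    (ENNReal.ofReal_le_iff_le_toReal (measure_ne_top _ _)).1 h34
  have := ProbabilityTheory.cond_isProbabilityMeasure hS0
  have hm := measurable_circleRep
  obtain ⟨r, hr⟩ := exists_window_pi (ProbabilityTheory.cond volume torusStrip)
    (g := fun z => (circleRep z.1 - circleRep z.2) ^ 2) (by fun_prop)
    (fun z => by
      obtain ⟨h1, h2⟩ := circleRep_mem z.1
      obtain ⟨h3, h4⟩ := circleRep_mem z.2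
      refine ⟨sq_nonneg _, ?_⟩
      rw [sq_le_one_iff_abs_le_one, abs_le]
      constructor <;> linarith) hD hδ hδD
  refine ⟨r, ?_⟩
  rw [stripAnnulus, volume_pi, measureReal_inter_univ_pi _ measurableSet_torusStrip hS0]
  gcongr

/-- A corner of the torus inside a thin strip annulus has a short side. -/
theorem sum_norm_sq_le_of_corner_mem_stripAnnulus {D : ℕ} {r δ : ℝ} {a b t : Fin D → UnitAddCircle}
    (h₀ : (fun i => (a i, b i)) ∈ stripAnnulus D r δ)
    (h₁ : (fun i => (a i + t i, b i)) ∈ stripAnnulus D r δ)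
    (h₂ : (fun i => (a i, b i + t i)) ∈ stripAnnulus D r δ) :
    ∑ i, ‖t i‖ ^ 2 ≤ δ := by
  set s : Fin D → ℝ := fun i => circleRep (a i + t i) - circleRep (a i) with hs
  set u : Fin D → ℝ := fun i => circleRep (a i) - circleRep (b i) with hu
  have hs' : ∀ i, circleRep (b i + t i) = circleRep (b i) + s i := fun i => by
    have := circleRep_sub_eq_of_mem_torusStrip (h₁.2 i trivial) (h₂.2 i trivial)
    simp only [hs]; linarith
  have e₀ : ∑ i, u i ^ 2 ∈ Ico r (r + δ) := h₀.1
  have e₁ : ∑ i, (u i + s i) ^ 2 ∈ Ico r (r + δ) := by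
    have h : ∑ i, (circleRep (a i + t i) - circleRep (b i)) ^ 2 ∈ Ico r (r + δ) := h₁.1
    convert h using 3 with i
    simp only [hu, hs]; ring
  have e₂ : ∑ i, (u i - s i) ^ 2 ∈ Ico r (r + δ) := by
    have h : ∑ i, (circleRep (a i) - circleRep (b i + t i)) ^ 2 ∈ Ico r (r + δ) := h₂.1
    convert h using 3 with i
    simp only [hs' i, hu]; ring
  have parallelogram :
      ∑ i, (u i + s i) ^ 2 + ∑ i, (u i - s i) ^ 2 = 2 * ∑ i, u i ^ 2 + 2 * ∑ i, s i ^ 2 := by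
    rw [Finset.mul_sum, Finset.mul_sum, ← Finset.sum_add_distrib, ← Finset.sum_add_distrib]
    exact Finset.sum_congr rfl fun i _ => by ring
  calc ∑ i, ‖t i‖ ^ 2 ≤ ∑ i, s i ^ 2 := Finset.sum_le_sum fun i _ =>
        (sq_le_sq₀ (norm_nonneg _) (abs_nonneg _)).2 (norm_le_abs_circleRep_sub (a i) (t i))
          |>.trans_eq (sq_abs _)
    _ ≤ δ := by linarith [e₀.1, e₁.2, e₂.2]

open Classical in
theorem exists_cornerFree_of_rotation {D N : ℕ} {r δ : ℝ} {θ : Fin D → UnitAddCircle}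
    (hθ : ∀ d : ℤ, 1 ≤ d → d ≤ (N - 1 : ℕ) → δ < ∑ i, ‖d • θ i‖ ^ 2) :
    ∃ A : Finset (ℤ × ℤ), ↑A ⊆ (Icc (1 : ℤ) N ×ˢ Icc (1 : ℤ) N) ∧ CornerFree ↑A ∧
      (N : ℝ) ^ 2 * volume.real (stripAnnulus D r δ) ≤ A.card := by
  set p : ℤ × ℤ → Fin D → UnitAddCircle × UnitAddCircle :=
    fun q i => (q.1 • θ i, q.2 • θ i) with hp
  set Q : Finset (ℤ × ℤ) := Finset.Icc (1 : ℤ) N ×ˢ Finset.Icc (1 : ℤ) N with hQ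
  obtain ⟨ω, hω⟩ := exists_translate_card_ge volume (measurableSet_stripAnnulus D r δ) Q p
  refine ⟨Q.filter fun q => p q + ω ∈ stripAnnulus D r δ, ?_, ?_, ?_⟩
  · intro q hq
    have := (Finset.mem_filter.1 hq).1
    simpa only [hQ, Finset.mem_product, Finset.mem_Icc, mem_prod, mem_Icc] using this
  · rintro ⟨x, y, d, hd, h₀, h₁, h₂⟩
    obtain ⟨m₀, h₀⟩ := Finset.mem_filter.1 (Finset.mem_coe.1 h₀)
    obtain ⟨m₁, h₁⟩ := Finset.mem_filter.1 (Finset.mem_coe.1 h₁)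
    obtain ⟨m₂, h₂⟩ := Finset.mem_filter.1 (Finset.mem_coe.1 h₂)
    have hle : ∑ i, ‖d • θ i‖ ^ 2 ≤ δ := by
      refine sum_norm_sq_le_of_corner_mem_stripAnnulus (r := r)
        (a := fun i => x • θ i + (ω i).1) (b := fun i => y • θ i + (ω i).2) h₀ ?_ ?_
      · convert h₁ using 1
        ext i <;> simp [hp, add_smul]; abel
      · convert h₂ using 1
        ext i <;> simp [hp, add_smul]; abel
    simp only [hQ, Finset.mem_product, Finset.mem_Icc] at m₀ m₁
    rcases lt_or_gt_of_ne hd with hneg | hpos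
    · have := hθ (-d) (by omega) (by omega)
      simp only [neg_smul, norm_neg] at this
      linarith
    · linarith [hθ d (by omega) (by omega)]
  · refine le_trans (le_of_eq ?_) hω
    simp [hQ, sq]

theorem exists_cornerFree_of_sqrt_le {D N : ℕ} (hD : 1 ≤ D) (hN : 1 ≤ N)
    (h : √D / 20 ≤ (N : ℝ) ^ (2 / (D : ℝ))) :
    ∃ A : Finset (ℤ × ℤ), ↑A ⊆ (Icc (1 : ℤ) N ×ˢ Icc (1 : ℤ) N) ∧ CornerFree ↑A ∧
      1 / 120 * √D * (3 / 4) ^ D * (N : ℝ) ^ (2 - 2 / (D : ℝ)) ≤ A.card := by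
  have hD' : (0 : ℝ) < D := by exact_mod_cast hD
  have hN' : (0 : ℝ) < N := by exact_mod_cast hN
  have hs : 0 < √(D : ℝ) := Real.sqrt_pos.2 hD'
  have hss : √(D : ℝ) * √D = D := Real.mul_self_sqrt hD'.le
  set M : ℝ := (N : ℝ) ^ (2 / (D : ℝ)) with hM
  have hM0 : 0 < M := by positivity
  set δ : ℝ := D / (20 * M) with hδdef
  have hδ : 0 < δ := by positivity
  have hδD : δ ≤ √D := by
    rw [hδdef, div_le_iff₀ (by positivity)]
    nlinarith
  set ρ : ℝ := (N : ℝ) ^ (-(1 / (D : ℝ))) with hρ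
  have hρ2 : ρ ^ 2 = M⁻¹ := by
    rw [hρ, hM, ← Real.rpow_natCast, ← Real.rpow_mul hN'.le, ← Real.rpow_neg hN'.le]
    congr 1; push_cast; ring
  have hρD : ρ ^ D = (N : ℝ)⁻¹ := by
    rw [hρ, ← Real.rpow_natCast, ← Real.rpow_mul hN'.le, ← Real.rpow_neg_one]
    congr 1; field_simp
  have hball := volume_torus_ball_le hD hδ (by positivity : 0 ≤ ρ)
    (by rw [hρ2, hδdef]; apply le_of_eq; field_simp)
  obtain ⟨θ, hθ⟩ := exists_rotation_avoiding_ball (N := N - 1) (D := D) (δ := δ) (by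
    rw [hρD] at hball
    calc ((N - 1 : ℕ) : ℝ) * _ ≤ ((N - 1 : ℕ) : ℝ) * (N : ℝ)⁻¹ := by gcongr
      _ < N * (N : ℝ)⁻¹ := by gcongr; omega
      _ = 1 := mul_inv_cancel₀ hN'.ne')
  obtain ⟨r, hr⟩ := exists_volume_stripAnnulus_ge hD hδ hδD
  obtain ⟨A, hA, hAc, hcard⟩ := exists_cornerFree_of_rotation (r := r) hθ
  refine ⟨A, hA, hAc, le_trans ?_ hcard⟩
  calc 1 / 120 * √D * (3 / 4) ^ D * (N : ℝ) ^ (2 - 2 / (D : ℝ))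
      = (N : ℝ) ^ 2 * ((3 / 4) ^ D * (δ / (6 * √D))) := by
        rw [Real.rpow_sub hN', ← hM, hδdef, Real.rpow_two]
        field_simp
        rw [Real.sq_sqrt hD'.le]; ring
    _ ≤ _ := by gcongr

/-- Below the range of the main construction, lowering the dimension improves the bound. -/
theorem bound_le_bound_pred {D N : ℕ} (hD : 25 ≤ D) (hN : 1 ≤ N)
    (h : (N : ℝ) ^ (2 / ((D + 1 : ℕ) : ℝ)) ≤ √((D + 1 : ℕ) : ℝ)) :
    √((D + 1 : ℕ) : ℝ) * (3 / 4) ^ (D + 1) * (N : ℝ) ^ (2 - 2 / ((D + 1 : ℕ) : ℝ)) ≤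
      √D * (3 / 4) ^ D * (N : ℝ) ^ (2 - 2 / (D : ℝ)) := by
  have hD' : (25 : ℝ) ≤ D := by exact_mod_cast hD
  have hN' : (0 : ℝ) < N := by exact_mod_cast hN
  set x : ℝ := (N : ℝ) ^ (2 / ((D : ℝ) * (D + 1))) with hx
  have hx0 : 0 < x := by positivity
  have hxD : x ^ D = (N : ℝ) ^ (2 / ((D + 1 : ℕ) : ℝ)) := by
    rw [hx, ← Real.rpow_natCast, ← Real.rpow_mul hN'.le]
    congr 1; push_cast; field_simp
  have hx1 : x ≤ 6 / 5 := by
    by_contra! hlt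
    have hb := one_add_mul_le_pow (a := x - 1) (by linarith) D
    rw [add_sub_cancel, hxD] at hb
    have h1 : 1 + (D : ℝ) * (1 / 5) < √((D + 1 : ℕ) : ℝ) := by nlinarith
    rw [Real.lt_sqrt (by positivity)] at h1
    push_cast at h1
    nlinarith
  have hsplit : (N : ℝ) ^ (2 - 2 / ((D + 1 : ℕ) : ℝ)) = (N : ℝ) ^ (2 - 2 / (D : ℝ)) * x := by
    rw [hx, ← Real.rpow_add hN']
    congr 1; push_cast; field_simp; ring
  have hsqrt : √((D + 1 : ℕ) : ℝ) * (9 / 10) ≤ √D := by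
    apply Real.le_sqrt_of_sq_le
    rw [mul_pow, Real.sq_sqrt (by positivity)]
    push_cast; linarith
  have hfac : √((D + 1 : ℕ) : ℝ) * (3 / 4 * x) ≤ √D :=
    (mul_le_mul_of_nonneg_left (by linarith) (Real.sqrt_nonneg _)).trans hsqrt
  calc _ = √((D + 1 : ℕ) : ℝ) * (3 / 4 * x) * ((3 / 4) ^ D * (N : ℝ) ^ (2 - 2 / (D : ℝ))) := by
        rw [hsplit]; ring
    _ ≤ √D * ((3 / 4) ^ D * (N : ℝ) ^ (2 - 2 / (D : ℝ))) := by gcongr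
    _ = _ := by ring

theorem corner_free_lower_bound :
    ∃ c : ℝ, 0 < c ∧ ∀ D N : ℕ, 1 ≤ D → 1 ≤ N →
      ∃ A : Finset (ℤ × ℤ), ↑A ⊆ (Set.Icc (1 : ℤ) N ×ˢ Set.Icc (1 : ℤ) N) ∧
        CornerFree ↑A ∧
        c * Real.sqrt D * (3/4) ^ D * (N : ℝ) ^ (2 - 2 / (D : ℝ)) ≤ A.card := by
  refine ⟨1 / 120, by norm_num, fun D N hD hN => ?_⟩
  induction D, hD using Nat.le_induction with
  | base =>
    refine exists_cornerFree_of_sqrt_le le_rfl hN ?_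
    have h1 : (1 : ℝ) ≤ (N : ℝ) ^ (2 / ((1 : ℕ) : ℝ)) :=
      Real.one_le_rpow (by exact_mod_cast hN) (by positivity)
    refine le_trans ?_ h1
    norm_num
  | succ D hD ih =>
    rcases le_or_gt (√((D + 1 : ℕ) : ℝ) / 20) ((N : ℝ) ^ (2 / ((D + 1 : ℕ) : ℝ))) with h | h
    · exact exists_cornerFree_of_sqrt_le (by omega) hN h
    obtain ⟨A, hA, hAc, hcard⟩ := ih
    refine ⟨A, hA, hAc, le_trans ?_ hcard⟩
    have h1 : (1 : ℝ) ≤ (N : ℝ) ^ (2 / ((D + 1 : ℕ) : ℝ)) :=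
      Real.one_le_rpow (by exact_mod_cast hN) (by positivity)
    have hD25 : 25 ≤ D := by
      have h2 : (20 : ℝ) < √((D + 1 : ℕ) : ℝ) := by linarith
      rw [Real.lt_sqrt (by norm_num)] at h2
      have h3 : 20 ^ 2 < D + 1 := by exact_mod_cast h2
      omega
    have := bound_le_bound_pred hD25 hN
      (h.le.trans (by linarith [Real.sqrt_nonneg ((D + 1 : ℕ) : ℝ)]))
    simp only [mul_assoc] at this ⊢
    gcongr
end

section
/- There exists a constant c > 0 such that for all sufficiently large N, the maximum size r_∠(N) of a corner-free subset of [N]² satisfies r_∠(N) ≥ c · (log₂ N)^{1/4} · N² / 2^{2√(2 log₂(4/3))·√(log₂ N)}. -/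
open Finset

theorem sum_Icc_exp_neg_mul_abs_le (M : ℕ) {t : ℝ} (ht : 0 < t) :
    ∑ k ∈ Icc (-(M : ℤ)) M, Real.exp (-t * |(k : ℝ)|) ≤ 2 * (1 + 1 / t) := by
  have hgeom : ∑ k ∈ range (M + 1), Real.exp (-t * k) ≤ 1 + 1 / t := by
    have hr : Real.exp (-t) < 1 := by simpa using ht
    calc ∑ k ∈ range (M + 1), Real.exp (-t * k)
        = ∑ k ∈ range (M + 1), Real.exp (-t) ^ k :=
          sum_congr rfl fun k _ => by rw [← Real.exp_nat_mul]; ring_nf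
      _ ≤ (1 - Real.exp (-t))⁻¹ := by
          rw [← tsum_geometric_of_lt_one (Real.exp_pos _).le hr]
          exact (summable_geometric_of_lt_one (Real.exp_pos _).le hr).sum_le_tsum _
            fun _ _ => by positivity
      _ ≤ (1 - 1 / (1 + t))⁻¹ := by
          have h1 : Real.exp (-t) ≤ 1 / (1 + t) := by
            rw [Real.exp_neg, inv_eq_one_div]
            exact one_div_le_one_div_of_le (by linarith) (by linarith [Real.add_one_le_exp t])
          have h2 : 0 < 1 - 1 / (1 + t) := by
            rw [sub_pos, div_lt_one (by linarith)]; linarith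
          gcongr
      _ = 1 + 1 / t := by
          have h : 1 - 1 / (1 + t) = t / (1 + t) := by field_simp; ring
          rw [h, inv_div, add_div, div_self ht.ne', add_comm]
  have hsub : Icc (-(M : ℤ)) M ⊆
      (range (M + 1)).image (fun k : ℕ => (k : ℤ)) ∪
        (range (M + 1)).image (fun k : ℕ => -(k : ℤ)) := by
    intro k hk
    rw [mem_Icc] at hk
    simp only [mem_union, mem_image, mem_range]
    rcases le_total 0 k with h | h
    · exact Or.inl ⟨k.toNat, by omega, by omega⟩
    · exact Or.inr ⟨(-k).toNat, by omega, by omega⟩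
  have hpos : ∀ k : ℤ, 0 ≤ Real.exp (-t * |(k : ℝ)|) := fun k => (Real.exp_pos _).le
  refine (sum_le_sum_of_subset_of_nonneg hsub fun k _ _ => hpos k).trans ?_
  have hunion := sum_union_inter (s₁ := (range (M + 1)).image (fun k : ℕ => (k : ℤ)))
    (s₂ := (range (M + 1)).image (fun k : ℕ => -(k : ℤ)))
    (f := fun k : ℤ => Real.exp (-t * |(k : ℝ)|))
  have hinter := sum_nonneg (s := (range (M + 1)).image (fun k : ℕ => (k : ℤ)) ∩
    (range (M + 1)).image (fun k : ℕ => -(k : ℤ))) fun k _ => hpos k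
  rw [sum_image (fun a _ b _ h => by simpa using h),
    sum_image (fun a _ b _ h => by simpa using h)] at hunion
  simp only [Int.cast_neg, Int.cast_natCast, abs_neg, Nat.abs_cast] at hunion
  linarith

/-- The integer points of `[-M, M]^D` in the open Euclidean ball of squared radius `w`. -/
noncomputable def latticeBall (D M : ℕ) (w : ℝ) : Finset (Fin D → ℤ) :=
  {v ∈ Fintype.piFinset fun _ : Fin D => Icc (-(M : ℤ)) M | ∑ i, (v i : ℝ) ^ 2 < w}

theorem card_latticeBall_le {D : ℕ} (hD : 0 < D) (M : ℕ) {w : ℝ} (hw : 0 < w) :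
    ((latticeBall D M w).card : ℝ) ≤ (2 * Real.exp 1 * (1 + √(w / D))) ^ D := by
  have hD' : (0 : ℝ) < D := by exact_mod_cast hD
  set s : ℝ := √(w / D) with hs
  have hspos : 0 < s := Real.sqrt_pos.2 (by positivity)
  have hs2 : s ^ 2 * D = w := by rw [hs, Real.sq_sqrt (by positivity)]; field_simp
  have hterm : ∀ v ∈ latticeBall D M w,
      (1 : ℝ) ≤ ∏ i, (Real.exp 1 * Real.exp (-(1 / s) * |(v i : ℝ)|)) := by
    intro v hv
    have hv2 : ∑ i, (v i : ℝ) ^ 2 < w := (mem_filter.1 hv).2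
    have hcs : (∑ i, |(v i : ℝ)|) ^ 2 ≤ D * ∑ i, (v i : ℝ) ^ 2 := by
      simpa using sq_sum_le_card_mul_sum_sq (s := univ) (f := fun i => |(v i : ℝ)|)
    have hl1 : ∑ i, |(v i : ℝ)| ≤ s * D := by
      refine abs_le_of_sq_le_sq' ?_ (by positivity) |>.2
      nlinarith
    simp_rw [← Real.exp_add]
    rw [← Real.exp_sum, Real.one_le_exp_iff, sum_add_distrib, ← mul_sum]
    have : 1 / s * ∑ i, |(v i : ℝ)| ≤ D := by
      rw [one_div_mul_eq_div, div_le_iff₀ hspos]; linarith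
    simp only [sum_const, card_univ, Fintype.card_fin, nsmul_eq_mul]
    linarith
  calc ((latticeBall D M w).card : ℝ)
      = ∑ v ∈ latticeBall D M w, (1 : ℝ) := by simp
    _ ≤ ∑ v ∈ latticeBall D M w, ∏ i, (Real.exp 1 * Real.exp (-(1 / s) * |(v i : ℝ)|)) :=
        sum_le_sum hterm
    _ ≤ ∑ v ∈ Fintype.piFinset fun _ : Fin D => Icc (-(M : ℤ)) M,
          ∏ i, (Real.exp 1 * Real.exp (-(1 / s) * |(v i : ℝ)|)) :=
        sum_le_sum_of_subset_of_nonneg (filter_subset _ _) fun _ _ _ => by positivity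
    _ = (Real.exp 1 * ∑ k ∈ Icc (-(M : ℤ)) M, Real.exp (-(1 / s) * |(k : ℝ)|)) ^ D := by
        rw [mul_sum]
        rw [← prod_univ_sum (fun _ : Fin D => Icc (-(M : ℤ)) M)
          (fun _ k => Real.exp 1 * Real.exp (-(1 / s) * |(k : ℝ)|))]
        simp
    _ ≤ (Real.exp 1 * (2 * (1 + 1 / (1 / s)))) ^ D := by
        gcongr
        exact sum_Icc_exp_neg_mul_abs_le M (by positivity)
    _ = (2 * Real.exp 1 * (1 + s)) ^ D := by rw [one_div_one_div]; ring

theorem sum_piFinset_sq_sum_le {α : Type*} [DecidableEq α] (D : ℕ) (T : Finset α) (g : α → ℝ)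
    {K : ℝ} (hg : ∑ t ∈ T, g t = 0) (hK : ∀ t ∈ T, g t ^ 2 ≤ K ^ 2) :
    ∑ x ∈ Fintype.piFinset fun _ : Fin D => T, (∑ i, g (x i)) ^ 2 ≤
      D * K ^ 2 * (T.card : ℝ) ^ D := by
  have hcross : ∀ i j : Fin D, i ≠ j →
      ∑ x ∈ Fintype.piFinset fun _ : Fin D => T, g (x i) * g (x j) = 0 := by
    intro i j hij
    have h := prod_univ_sum (fun _ : Fin D => T)
      (fun k t => (if k = i then g t else 1) * (if k = j then g t else 1))
    simp only [prod_mul_distrib, prod_ite_eq', mem_univ, if_true] at h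
    rw [← h]
    exact prod_eq_zero (mem_univ i) (by simpa [hij] using hg)
  have hcard : (((Fintype.piFinset fun _ : Fin D => T).card : ℕ) : ℝ) = (T.card : ℝ) ^ D := by
    simp
  calc ∑ x ∈ Fintype.piFinset fun _ : Fin D => T, (∑ i, g (x i)) ^ 2
      = ∑ i, ∑ j, ∑ x ∈ Fintype.piFinset fun _ : Fin D => T, g (x i) * g (x j) := by
        simp_rw [sq, sum_mul_sum]
        rw [sum_comm]
        exact sum_congr rfl fun i _ => sum_comm
    _ = ∑ i, ∑ x ∈ Fintype.piFinset fun _ : Fin D => T, g (x i) * g (x i) :=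
        sum_congr rfl fun i _ =>
          sum_eq_single i (fun j _ hj => hcross i j hj.symm) (by simp)
    _ ≤ ∑ _i : Fin D, ∑ _x ∈ Fintype.piFinset fun _ : Fin D => T, K ^ 2 := by
        refine sum_le_sum fun i _ => sum_le_sum fun x hx => ?_
        rw [← sq]
        exact hK _ (Fintype.mem_piFinset.1 hx i)
    _ = D * K ^ 2 * (T.card : ℝ) ^ D := by
        rw [sum_const, sum_const, nsmul_eq_mul, nsmul_eq_mul, hcard]
        simp; ring

theorem exists_dense_window {α : Type*} [DecidableEq α] {D : ℕ} (hD : 0 < D) (T : Finset α)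
    (f : α → ℝ) {K w : ℝ} (hK : 0 < K) (hf : ∀ t ∈ T, 0 ≤ f t ∧ f t ≤ K) (hw : 0 < w)
    (hwK : w ≤ K * √D) :
    ∃ R : ℝ, 3 / 20 * (w / (K * √D)) * (T.card : ℝ) ^ D ≤
      (({x ∈ Fintype.piFinset fun _ : Fin D => T |
        R ≤ ∑ i, f (x i) ∧ ∑ i, f (x i) < R + w}).card : ℝ) := by
  have hD' : (0 : ℝ) < D := by exact_mod_cast hD
  have hsD : 0 < √(D : ℝ) := Real.sqrt_pos.2 hD'
  rcases T.eq_empty_or_nonempty with rfl | hT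
  · exact ⟨0, by simp [hD.ne']⟩
  have hTc : (0 : ℝ) < T.card := by exact_mod_cast hT.card_pos
  set μ : ℝ := (∑ t ∈ T, f t) / T.card with hμ
  have hμ0 : 0 ≤ μ := div_nonneg (sum_nonneg fun t ht => (hf t ht).1) hTc.le
  have hμK : μ ≤ K := by
    rw [hμ, div_le_iff₀ hTc]
    calc ∑ t ∈ T, f t ≤ ∑ _t ∈ T, K := sum_le_sum fun t ht => (hf t ht).2
      _ = K * T.card := by simp [mul_comm]
  set P := Fintype.piFinset fun _ : Fin D => T with hP
  have hPc : (P.card : ℝ) = (T.card : ℝ) ^ D := by simp [hP]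
  have hvar := sum_piFinset_sq_sum_le D T (fun t => f t - μ) (K := K)
    (by simp only [sum_sub_distrib, sum_const, nsmul_eq_mul, hμ]; field_simp; ring)
    (fun t ht => by
      have := hf t ht
      exact sq_le_sq' (by linarith) (by linarith))
  simp only [sum_sub_distrib, sum_const, card_univ, Fintype.card_fin, nsmul_eq_mul] at hvar
  set H : ℝ := 2 * (K * √D) with hH
  have hH0 : 0 < H := by positivity
  have hH2 : H ^ 2 = 4 * (D * K ^ 2) := by
    rw [hH, mul_pow, mul_pow, Real.sq_sqrt hD'.le]; ring
  set G := {x ∈ P | |∑ i, f (x i) - D * μ| < H} with hG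
  have hGc : 3 / 4 * (T.card : ℝ) ^ D ≤ G.card := by
    have hbad : H ^ 2 * (({x ∈ P | ¬ |∑ i, f (x i) - D * μ| < H}).card : ℝ) ≤
        D * K ^ 2 * (T.card : ℝ) ^ D := by
      refine le_trans ?_ hvar
      rw [mul_comm, ← nsmul_eq_mul, ← sum_const]
      refine (sum_le_sum fun x hx => ?_).trans
        (sum_le_sum_of_subset_of_nonneg (filter_subset _ _) fun _ _ _ => sq_nonneg _)
      have := (mem_filter.1 hx).2
      rw [← sq_abs (∑ i, f (x i) - D * μ)]
      exact pow_le_pow_left₀ hH0.le (not_lt.1 this) 2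
    have hsplit : (G.card : ℝ) + (({x ∈ P | ¬ |∑ i, f (x i) - D * μ| < H}).card : ℝ) =
        (T.card : ℝ) ^ D := by
      rw [← hPc]; exact_mod_cast card_filter_add_card_filter_not _
    rw [hH2] at hbad
    have hDK : 0 < D * K ^ 2 := by positivity
    have : 4 * (({x ∈ P | ¬ |∑ i, f (x i) - D * μ| < H}).card : ℝ) ≤ (T.card : ℝ) ^ D :=
      le_of_mul_le_mul_left (by linarith) hDK
    linarith
  set n : ℕ := ⌊2 * H / w⌋₊ + 1 with hn
  have hmaps : ∀ x ∈ G, ⌊(∑ i, f (x i) - D * μ + H) / w⌋₊ ∈ range n := by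
    intro x hx
    have hx' := abs_lt.1 (mem_filter.1 hx).2
    rw [mem_range, hn, Nat.lt_succ_iff]
    refine Nat.floor_le_floor ?_
    gcongr
    linarith
  have hnle : (n : ℝ) ≤ 5 * (K * √D / w) := by
    have h1 : (⌊2 * H / w⌋₊ : ℝ) ≤ 2 * H / w := Nat.floor_le (by positivity)
    have h2 : 1 ≤ K * √D / w := (one_le_div hw).2 hwK
    have h3 : 2 * H / w = 4 * (K * √D / w) := by rw [hH]; ring
    rw [hn]; push_cast; linarith
  have hn0 : (0 : ℝ) < n := by rw [hn]; positivity
  obtain ⟨k, -, hk⟩ := exists_le_card_fiber_of_nsmul_le_card_of_maps_to (M := ℝ) hmaps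
    ⟨0, by simp [hn]⟩ (b := (G.card : ℝ) / n)
    (by rw [card_range, nsmul_eq_mul, mul_div_cancel₀ _ hn0.ne'])
  refine ⟨D * μ - H + k * w, le_trans ?_ (hk.trans ?_)⟩
  · rw [le_div_iff₀ hn0]
    refine le_trans ?_ hGc
    calc 3 / 20 * (w / (K * √D)) * (T.card : ℝ) ^ D * n
        ≤ 3 / 20 * (w / (K * √D)) * (T.card : ℝ) ^ D * (5 * (K * √D / w)) := by gcongr
      _ = 3 / 4 * (T.card : ℝ) ^ D := by field_simp; ring
  · gcongr
    intro x hx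
    simp only [hG, mem_filter] at hx ⊢
    have hx' := abs_lt.1 hx.1.2
    have hnn : 0 ≤ (∑ i, f (x i) - D * μ + H) / w := div_nonneg (by linarith) hw.le
    have h1 := (Nat.floor_eq_iff hnn).1 hx.2
    rw [le_div_iff₀ hw, div_lt_iff₀ hw] at h1
    exact ⟨hx.1.1, by linarith, by linarith⟩

theorem three_mul_sq_le_four_mul_card (m : ℕ) :
    3 * (2 * m + 1) ^ 2 ≤ 4 * ({p ∈ range (2 * m + 1) ×ˢ range (2 * m + 1) |
      m ≤ p.1 + p.2 ∧ p.1 + p.2 ≤ 3 * m}).card := by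
  have hcard : ({p ∈ range (2 * m + 1) ×ˢ range (2 * m + 1) |
      m ≤ p.1 + p.2 ∧ p.1 + p.2 ≤ 3 * m}).card =
      ∑ a ∈ range (2 * m + 1), ({b ∈ range (2 * m + 1) | m ≤ a + b ∧ a + b ≤ 3 * m}).card := by
    simp only [card_filter, sum_product]
  have hlow : ∀ a ∈ range (m + 1),
      m + 1 + a ≤ ({b ∈ range (2 * m + 1) | m ≤ a + b ∧ a + b ≤ 3 * m}).card := by
    intro a ha
    rw [mem_range] at ha
    calc m + 1 + a = (Icc (m - a) (2 * m)).card := by rw [Nat.card_Icc]; omega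
      _ ≤ _ := card_le_card fun b hb => by
        simp only [mem_Icc, mem_filter, mem_range] at hb ⊢; omega
  have hhigh : ∀ a ∈ range m,
      m + 1 + a ≤ ({b ∈ range (2 * m + 1) |
        m ≤ (2 * m - a) + b ∧ (2 * m - a) + b ≤ 3 * m}).card := by
    intro a ha
    rw [mem_range] at ha
    calc m + 1 + a = (range (m + 1 + a)).card := by rw [card_range]
      _ ≤ _ := card_le_card fun b hb => by
        simp only [mem_filter, mem_range] at hb ⊢; omega
  have hgauss : ∀ n : ℕ, 2 * ∑ a ∈ range n, (m + 1 + a) + n = 2 * n * (m + 1) + n * n := by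
    intro n
    induction n with
    | zero => simp
    | succ n ih => rw [sum_range_succ]; linarith
  have hsplit : ∑ a ∈ range (2 * m + 1),
      ({b ∈ range (2 * m + 1) | m ≤ a + b ∧ a + b ≤ 3 * m}).card =
      ∑ a ∈ range (m + 1), ({b ∈ range (2 * m + 1) | m ≤ a + b ∧ a + b ≤ 3 * m}).card +
      ∑ a ∈ range m, ({b ∈ range (2 * m + 1) |
        m ≤ (2 * m - a) + b ∧ (2 * m - a) + b ≤ 3 * m}).card := by
    rw [show 2 * m + 1 = (m + 1) + m by ring, sum_range_add]
    congr 1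
    rw [← sum_range_reflect]
    refine sum_congr rfl fun a ha => ?_
    rw [mem_range] at ha
    rw [show m + 1 + (m - 1 - a) = 2 * m - a by omega]
  have h1 := sum_le_sum hlow
  have h2 := sum_le_sum hhigh
  have h3 := hgauss (m + 1)
  have h4 := hgauss m
  rw [hcard, hsplit]
  nlinarith

/-- Pairs of residues modulo `2m+1` whose canonical representatives have sum in `[m, 3m]`. -/
def centralPairs (m : ℕ) : Finset (ZMod (2 * m + 1) × ZMod (2 * m + 1)) :=
  {p | m ≤ p.1.val + p.2.val ∧ p.1.val + p.2.val ≤ 3 * m}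

theorem three_mul_sq_le_four_mul_card_centralPairs (m : ℕ) :
    3 * (2 * m + 1) ^ 2 ≤ 4 * (centralPairs m).card := by
  refine (three_mul_sq_le_four_mul_card m).trans (Nat.mul_le_mul_left 4 ?_)
  refine card_le_card_of_injOn (fun p => ((p.1 : ZMod (2 * m + 1)), (p.2 : ZMod (2 * m + 1))))
    ?_ ?_
  · rintro ⟨a, b⟩ h
    simp only [coe_filter, mem_product, mem_range, Set.mem_ofPred_eq] at h
    simp only [centralPairs, coe_filter, mem_univ, true_and, Set.mem_ofPred_eq,
      ZMod.val_cast_of_lt h.1.1, ZMod.val_cast_of_lt h.1.2]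
    exact h.2
  · rintro ⟨a, b⟩ h ⟨a', b'⟩ h' heq
    simp only [coe_filter, mem_product, mem_range, Set.mem_ofPred_eq] at h h'
    simp only [Prod.mk.injEq] at heq ⊢
    have h1 := congrArg ZMod.val heq.1
    have h2 := congrArg ZMod.val heq.2
    rw [ZMod.val_cast_of_lt h.1.1, ZMod.val_cast_of_lt h'.1.1] at h1
    rw [ZMod.val_cast_of_lt h.1.2, ZMod.val_cast_of_lt h'.1.2] at h2
    exact ⟨h1, h2⟩

theorem exists_direction_avoiding {D N M : ℕ} [Fact M.Prime] (hNM : N ≤ M)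
    (B : Finset (Fin D → ℤ)) (hB : 2 * N * B.card < M ^ D) :
    ∃ θ : Fin D → ZMod M, ∀ d : ℤ, d ≠ 0 → |d| < N → ∀ v ∈ B,
      ∃ i, (d : ZMod M) * θ i ≠ (v i : ZMod M) := by
  classical
  set bad : Finset (Fin D → ZMod M) := (Ioo (-(N : ℤ)) N ×ˢ B).image
    fun p i => (p.1 : ZMod M)⁻¹ * (p.2 i : ZMod M) with hbad
  have hcard : bad.card < (univ : Finset (Fin D → ZMod M)).card := by
    refine card_image_le.trans_lt ?_
    rw [card_product, Int.card_Ioo, card_univ, Fintype.card_pi]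
    simp only [ZMod.card, prod_const, card_univ, Fintype.card_fin]
    refine lt_of_le_of_lt (Nat.mul_le_mul_right _ ?_) hB
    omega
  obtain ⟨θ, -, hθ⟩ := exists_mem_notMem_of_card_lt_card hcard
  refine ⟨θ, fun d hd hdN v hv => ?_⟩
  by_contra! h
  refine hθ (mem_image.2 ⟨(d, v), ?_, ?_⟩)
  · rw [mem_product, mem_Ioo]
    exact ⟨abs_lt.1 hdN, hv⟩
  · have hdM : (d : ZMod M) ≠ 0 := by
      rw [Ne, ZMod.intCast_zmod_eq_zero_iff_dvd]
      intro hdvd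
      exact hd (Int.eq_zero_of_abs_lt_dvd hdvd (by omega))
    funext i
    simp only [← h i]
    rw [inv_mul_cancel_left₀ hdM]

theorem exists_translate_card_le {G ι : Type*} [AddGroup G] [Fintype G] [DecidableEq G]
    (I : Finset ι) (p : ι → G) (S : Finset G) :
    ∃ g : G, I.card * S.card ≤ Fintype.card G * ({i ∈ I | p i + g ∈ S}).card := by
  have hsum : ∑ g : G, ({i ∈ I | p i + g ∈ S}).card = I.card * S.card := by
    simp only [card_filter]
    rw [sum_comm, ← smul_eq_mul, ← sum_const]
    refine sum_congr rfl fun i _ => ?_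
    exact (Equiv.sum_comp (Equiv.addLeft (p i)) fun g => if g ∈ S then 1 else 0).trans (by simp)
  obtain ⟨g, -, hg⟩ := exists_max_image univ (fun g : G => ({i ∈ I | p i + g ∈ S}).card)
    univ_nonempty
  refine ⟨g, ?_⟩
  rw [← hsum, ← card_univ, ← smul_eq_mul]
  exact sum_le_card_nsmul _ _ _ hg

theorem cornerFree_of_direction {D m N : ℕ} {R w : ℝ}
    {θ : Fin D → ZMod (2 * m + 1)}
    (hθ : ∀ d : ℤ, d ≠ 0 → |d| < N → ∀ v ∈ latticeBall D (2 * m + 1) w,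
      ∃ i, (d : ZMod (2 * m + 1)) * θ i ≠ (v i : ZMod (2 * m + 1)))
    (g : Fin D → ZMod (2 * m + 1) × ZMod (2 * m + 1)) {A : Set (ℤ × ℤ)}
    (hbox : A ⊆ Set.Icc (1 : ℤ) N ×ˢ Set.Icc (1 : ℤ) N)
    (hcentral : ∀ z ∈ A, ∀ i, (z.1 * θ i + (g i).1, z.2 * θ i + (g i).2) ∈ centralPairs m)
    (hwindow : ∀ z ∈ A,
      R ≤ ∑ i, (((z.1 * θ i + (g i).1).val : ℝ) - (z.2 * θ i + (g i).2).val) ^ 2 ∧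
      ∑ i, (((z.1 * θ i + (g i).1).val : ℝ) - (z.2 * θ i + (g i).2).val) ^ 2 < R + w) :
    CornerFree A := by
  rintro ⟨x, y, d, hd, h₀, h₁, h₂⟩
  have hdN : |d| < N := by
    have hx := (Set.mem_prod.1 (hbox h₀)).1
    have hx' := (Set.mem_prod.1 (hbox h₁)).1
    simp only [Set.mem_Icc] at hx hx'
    rw [abs_lt]
    omega
  set a : Fin D → ℕ := fun i => ((x : ZMod (2 * m + 1)) * θ i + (g i).1).val with ha
  set b : Fin D → ℕ := fun i => ((y : ZMod (2 * m + 1)) * θ i + (g i).2).val with hb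
  set a' : Fin D → ℕ := fun i =>
    (((x + d : ℤ) : ZMod (2 * m + 1)) * θ i + (g i).1).val with ha'
  set b' : Fin D → ℕ := fun i =>
    (((y + d : ℤ) : ZMod (2 * m + 1)) * θ i + (g i).2).val with hb'
  have hc₁ : ∀ i, m ≤ a' i + b i ∧ a' i + b i ≤ 3 * m := fun i =>
    (mem_filter.1 (hcentral _ h₁ i)).2
  have hc₂ : ∀ i, m ≤ a i + b' i ∧ a i + b' i ≤ 3 * m := fun i =>
    (mem_filter.1 (hcentral _ h₂ i)).2
  have hsum : ∀ i, (a' i : ℤ) + b i = a i + b' i := by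
    intro i
    have hmod : (((a' i : ℤ) + b i - (a i + b' i) : ℤ) : ZMod (2 * m + 1)) = 0 := by
      simp only [ha, hb, ha', hb']
      push_cast
      simp only [ZMod.natCast_val, ZMod.cast_id', id_eq]
      ring
    rw [ZMod.intCast_zmod_eq_zero_iff_dvd] at hmod
    have := Int.eq_zero_of_abs_lt_dvd hmod (by
      have := hc₁ i
      have := hc₂ i
      rw [abs_lt]
      push_cast
      omega)
    linarith
  set v : Fin D → ℤ := fun i => (a' i : ℤ) - a i with hv
  have hvd : ∀ i, (d : ZMod (2 * m + 1)) * θ i = (v i : ZMod (2 * m + 1)) := by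
    intro i
    simp only [hv, ha, ha']
    push_cast
    simp only [ZMod.natCast_val, ZMod.cast_id', id_eq]
    ring
  have hmem : v ∈ latticeBall D (2 * m + 1) w := by
    refine mem_filter.2 ⟨Fintype.mem_piFinset.2 fun i => ?_, ?_⟩
    · have h1 : a i < 2 * m + 1 := ZMod.val_lt _
      have h2 : a' i < 2 * m + 1 := ZMod.val_lt _
      simp only [hv, mem_Icc]
      push_cast
      omega
    · have w₀ := (hwindow _ h₀).1
      have w₁ := (hwindow _ h₁).2
      have w₂ := (hwindow _ h₂).2
      have hpar : ∑ i, ((a' i : ℝ) - b i) ^ 2 + ∑ i, ((a i : ℝ) - b' i) ^ 2 =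
          2 * ∑ i, ((a i : ℝ) - b i) ^ 2 + 2 * ∑ i, (v i : ℝ) ^ 2 := by
        rw [mul_sum, mul_sum, ← sum_add_distrib, ← sum_add_distrib]
        refine sum_congr rfl fun i _ => ?_
        have h : (a' i : ℝ) + b i = a i + b' i := by exact_mod_cast hsum i
        have hb'i : (b' i : ℝ) = a' i + b i - a i := by linarith
        simp only [hv, hb'i]
        push_cast
        ring
      change R ≤ ∑ i, ((a i : ℝ) - b i) ^ 2 at w₀
      change ∑ i, ((a' i : ℝ) - b i) ^ 2 < R + w at w₁
      change ∑ i, ((a i : ℝ) - b' i) ^ 2 < R + w at w₂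
      linarith
  obtain ⟨i, hi⟩ := hθ d hd hdN v hmem
  exact hi (hvd i)

theorem exists_cornerFree_of_card_latticeBall {D m N : ℕ} (hD : 0 < D)
    (hp : (2 * m + 1).Prime) (hN : N ≤ 2 * m + 1) {δ : ℝ} (hδ : 0 < δ) (hδD : δ ≤ √D)
    (hball : 2 * N * (latticeBall D (2 * m + 1) (δ * (2 * m + 1) ^ 2)).card <
      (2 * m + 1) ^ D) :
    ∃ A : Finset (ℤ × ℤ), ↑A ⊆ (Set.Icc (1 : ℤ) N ×ˢ Set.Icc (1 : ℤ) N) ∧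
      CornerFree ↑A ∧ 3 / 20 * (δ / √D) * (3 / 4) ^ D * (N : ℝ) ^ 2 ≤ A.card := by
  have : Fact (2 * m + 1).Prime := ⟨hp⟩
  obtain ⟨θ, hθ⟩ := exists_direction_avoiding hN _ hball
  have hsD : 0 < √(D : ℝ) := Real.sqrt_pos.2 (by exact_mod_cast hD)
  set f : ZMod (2 * m + 1) × ZMod (2 * m + 1) → ℝ :=
    fun p => ((p.1.val : ℝ) - p.2.val) ^ 2 with hf
  have hfle : ∀ p, f p ≤ (2 * m + 1) ^ 2 := by
    intro p
    have h1 : (p.1.val : ℝ) < 2 * m + 1 := by exact_mod_cast ZMod.val_lt p.1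
    have h2 : (p.2.val : ℝ) < 2 * m + 1 := by exact_mod_cast ZMod.val_lt p.2
    have h3 : (0 : ℝ) ≤ p.1.val := Nat.cast_nonneg _
    have h4 : (0 : ℝ) ≤ p.2.val := Nat.cast_nonneg _
    exact sq_le_sq' (by linarith) (by linarith)
  obtain ⟨R, hR⟩ := exists_dense_window hD (centralPairs m) f (K := (2 * m + 1) ^ 2)
    (w := δ * (2 * m + 1) ^ 2) (by positivity) (fun p _ => ⟨sq_nonneg _, hfle p⟩)
    (by positivity) (by rw [mul_comm]; gcongr)
  set S := {x ∈ Fintype.piFinset fun _ : Fin D => centralPairs m |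
    R ≤ ∑ i, f (x i) ∧ ∑ i, f (x i) < R + δ * (2 * m + 1) ^ 2}
  obtain ⟨g, hg⟩ := exists_translate_card_le (Icc (1 : ℤ) N ×ˢ Icc (1 : ℤ) N)
    (fun z i => ((z.1 : ZMod (2 * m + 1)) * θ i, (z.2 : ZMod (2 * m + 1)) * θ i)) S
  set A := {z ∈ Icc (1 : ℤ) N ×ˢ Icc (1 : ℤ) N |
    (fun i => ((z.1 : ZMod (2 * m + 1)) * θ i, (z.2 : ZMod (2 * m + 1)) * θ i)) + g ∈ S}
  have hbox : (A : Set (ℤ × ℤ)) ⊆ Set.Icc (1 : ℤ) N ×ˢ Set.Icc (1 : ℤ) N := by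
    intro z hz
    have := (mem_filter.1 (mem_coe.1 hz)).1
    simpa only [mem_product, mem_Icc, Set.mem_prod, Set.mem_Icc] using this
  have hAS : ∀ z ∈ (A : Set (ℤ × ℤ)), _ := fun z hz => mem_filter.1 (mem_filter.1 (mem_coe.1 hz)).2
  refine ⟨A, hbox, cornerFree_of_direction hθ g hbox
    (fun z hz i => Fintype.mem_piFinset.1 (hAS z hz).1 i) (fun z hz => (hAS z hz).2), ?_⟩
  have hcardG : (Fintype.card (Fin D → ZMod (2 * m + 1) × ZMod (2 * m + 1)) : ℝ) =
      ((2 * m + 1 : ℝ) ^ 2) ^ D := by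
    simp [Fintype.card_pi, ZMod.card, sq]
  have hgR : (N : ℝ) ^ 2 * S.card ≤ ((2 * m + 1 : ℝ) ^ 2) ^ D * A.card := by
    rw [← hcardG]
    have : (Icc (1 : ℤ) N ×ˢ Icc (1 : ℤ) N).card = N ^ 2 := by
      rw [card_product, Int.card_Icc]; simp [sq]
    rw [this] at hg
    exact_mod_cast hg
  have hcp : 3 / 4 * (2 * m + 1 : ℝ) ^ 2 ≤ (centralPairs m).card := by
    have : (3 : ℝ) * (2 * m + 1) ^ 2 ≤ 4 * (centralPairs m).card := by
      exact_mod_cast three_mul_sq_le_four_mul_card_centralPairs m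
    linarith
  have hcpD : (3 / 4 : ℝ) ^ D * ((2 * m + 1 : ℝ) ^ 2) ^ D ≤ ((centralPairs m).card : ℝ) ^ D := by
    rw [← mul_pow]; gcongr
  have hratio : δ * (2 * m + 1 : ℝ) ^ 2 / ((2 * m + 1) ^ 2 * √D) = δ / √D := by
    field_simp
  rw [hratio] at hR
  have hpow : (0 : ℝ) < ((2 * m + 1 : ℝ) ^ 2) ^ D := by positivity
  refine le_of_mul_le_mul_left ?_ hpow
  calc ((2 * m + 1 : ℝ) ^ 2) ^ D * (3 / 20 * (δ / √D) * (3 / 4) ^ D * (N : ℝ) ^ 2)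
      = (N : ℝ) ^ 2 * (3 / 20 * (δ / √D) * ((3 / 4) ^ D * ((2 * m + 1 : ℝ) ^ 2) ^ D)) := by ring
    _ ≤ (N : ℝ) ^ 2 * (3 / 20 * (δ / √D) * ((centralPairs m).card : ℝ) ^ D) := by gcongr
    _ ≤ (N : ℝ) ^ 2 * S.card := by gcongr
    _ ≤ _ := hgR

/-- The lower bound `√D (3/4)^D N^{2 - 2/D}` for corner-free sets, in every dimension `D` that is
not too large in terms of `N`. -/
theorem exists_cornerFree_of_dimension {D N : ℕ} (hD : 0 < D) (hN : 0 < N)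
    (hDN : √D ≤ (N : ℝ) ^ (2 / D : ℝ)) :
    ∃ A : Finset (ℤ × ℤ), ↑A ⊆ (Set.Icc (1 : ℤ) N ×ˢ Set.Icc (1 : ℤ) N) ∧
      CornerFree ↑A ∧ 1 / 20000 * √D * (3 / 4) ^ D * (N : ℝ) ^ 2 / (N : ℝ) ^ (2 / D : ℝ) ≤
        A.card := by
  have hDR : (1 : ℝ) ≤ D := by exact_mod_cast hD
  have hD' : (0 : ℝ) < D := by linarith
  have hNR : (1 : ℝ) ≤ N := by exact_mod_cast hN
  have hsD : 0 < √(D : ℝ) := Real.sqrt_pos.2 hD'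
  have he := Real.exp_one_lt_three
  set Q : ℝ := (2 * N : ℝ) ^ (1 / D : ℝ) with hQ
  have hQ0 : 0 < Q := by positivity
  have hQD : Q ^ D = 2 * N := by
    rw [hQ, ← Real.rpow_natCast, ← Real.rpow_mul (by positivity), one_div_mul_cancel hD'.ne',
      Real.rpow_one]
  have hQle : Q ≤ 2 * N := by
    calc Q ≤ (2 * N : ℝ) ^ (1 : ℝ) :=
          Real.rpow_le_rpow_of_exponent_le (by linarith) (by rw [div_le_one hD']; exact hDR)
      _ = 2 * N := Real.rpow_one _
  have hQ2 : Q ^ 2 = 4 ^ (1 / D : ℝ) * (N : ℝ) ^ (2 / D : ℝ) := by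
    rw [hQ, ← Real.rpow_natCast, ← Real.rpow_mul (by positivity), Real.mul_rpow (by norm_num)
      (by positivity), show (4 : ℝ) = 2 ^ (2 : ℝ) by norm_num, ← Real.rpow_mul (by norm_num)]
    push_cast
    ring_nf
  have h4 : (1 : ℝ) ≤ 4 ^ (1 / D : ℝ) := Real.one_le_rpow (by norm_num) (by positivity)
  have h4' : (4 : ℝ) ^ (1 / D : ℝ) ≤ 4 := by
    calc (4 : ℝ) ^ (1 / D : ℝ) ≤ 4 ^ (1 : ℝ) :=
          Real.rpow_le_rpow_of_exponent_le (by norm_num) (by rw [div_le_one hD']; exact hDR)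
      _ = 4 := Real.rpow_one _
  have hNpos : 0 < (N : ℝ) ^ (2 / D : ℝ) := by positivity
  have hQ2lo : (N : ℝ) ^ (2 / D : ℝ) ≤ Q ^ 2 := by rw [hQ2]; nlinarith
  have hQ2hi : Q ^ 2 ≤ 4 * (N : ℝ) ^ (2 / D : ℝ) := by rw [hQ2]; gcongr
  obtain ⟨p, hpN, hp⟩ := Nat.exists_infinite_primes (17 * N)
  obtain ⟨m, rfl⟩ : ∃ m, p = 2 * m + 1 := hp.odd_of_ne_two (by omega)
  have hpR : (17 : ℝ) * N ≤ 2 * m + 1 := by exact_mod_cast hpN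
  set δ : ℝ := D / (24 * Q) ^ 2 with hδ
  have hδ0 : 0 < δ := by positivity
  have hδD : δ ≤ √D := by
    rw [hδ, div_le_iff₀ (by positivity)]
    have hs : (D : ℝ) = √D * √D := (Real.mul_self_sqrt hD'.le).symm
    calc (D : ℝ) = √D * √D := hs
      _ ≤ √D * (24 * Q) ^ 2 := by gcongr; nlinarith
  have hsqrt : √(δ * (2 * m + 1 : ℝ) ^ 2 / D) = (2 * m + 1) / (24 * Q) := by
    rw [show δ * (2 * m + 1 : ℝ) ^ 2 / D = ((2 * m + 1) / (24 * Q)) ^ 2 by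
      rw [hδ]; field_simp]
    exact Real.sqrt_sq (by positivity)
  have hball : 2 * N * (latticeBall D (2 * m + 1) (δ * (2 * m + 1) ^ 2)).card <
      (2 * m + 1) ^ D := by
    have h := card_latticeBall_le hD (2 * m + 1) (w := δ * (2 * m + 1 : ℝ) ^ 2) (by positivity)
    rw [hsqrt] at h
    have hlt : (2 * N * (latticeBall D (2 * m + 1) (δ * (2 * m + 1) ^ 2)).card : ℝ) <
        (2 * m + 1) ^ D := by
      calc (2 * N * (latticeBall D (2 * m + 1) (δ * (2 * m + 1) ^ 2)).card : ℝ)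
          ≤ Q ^ D * (2 * Real.exp 1 * (1 + (2 * m + 1) / (24 * Q))) ^ D := by
            rw [hQD]; gcongr
        _ = (Real.exp 1 * (2 * Q + (2 * m + 1) / 12)) ^ D := by
            rw [← mul_pow]; congr 1; field_simp; ring
        _ < (2 * m + 1) ^ D := by
            refine pow_lt_pow_left₀ ?_ (by positivity) hD.ne'
            calc Real.exp 1 * (2 * Q + (2 * m + 1) / 12)
                ≤ 3 * (2 * Q + (2 * m + 1) / 12) := by gcongr
              _ < 2 * m + 1 := by linarith
    exact_mod_cast hlt
  obtain ⟨A, hbox, hfree, hcard⟩ :=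
    exists_cornerFree_of_card_latticeBall hD hp (by omega) hδ0 hδD hball
  refine ⟨A, hbox, hfree, le_trans ?_ hcard⟩
  have hδs : 1 / 2304 * √D / (N : ℝ) ^ (2 / D : ℝ) ≤ δ / √D := by
    rw [hδ, div_right_comm, Real.div_sqrt, mul_comm (1 / 2304 : ℝ), mul_div_assoc,
      div_eq_mul_inv √(D : ℝ)]
    gcongr
    rw [inv_eq_one_div, div_le_div_iff₀ (by positivity) (by positivity)]
    nlinarith
  calc 1 / 20000 * √D * (3 / 4) ^ D * (N : ℝ) ^ 2 / (N : ℝ) ^ (2 / D : ℝ)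
      = 2304 / 20000 * (1 / 2304 * √D / (N : ℝ) ^ (2 / D : ℝ)) * (3 / 4) ^ D * (N : ℝ) ^ 2 := by
        ring
    _ ≤ 3 / 20 * (δ / √D) * (3 / 4) ^ D * (N : ℝ) ^ 2 := by
        have : (2304 / 20000 : ℝ) ≤ 3 / 20 := by norm_num
        gcongr

theorem corner_free_corollary :
    ∃ c : ℝ, 0 < c ∧ ∃ N₀ : ℕ, ∀ N : ℕ, N₀ ≤ N →
      ∃ A : Finset (ℤ × ℤ), ↑A ⊆ (Set.Icc (1 : ℤ) N ×ˢ Set.Icc (1 : ℤ) N) ∧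
        CornerFree ↑A ∧
        c * (Real.logb 2 N) ^ ((1 : ℝ)/4) * (N : ℝ) ^ 2
            / 2 ^ (2 * Real.sqrt (2 * Real.logb 2 (4/3)) * Real.sqrt (Real.logb 2 N))
          ≤ A.card := by
  refine ⟨1 / 20000 * (3 / 8), by norm_num, 2, fun N hN => ?_⟩
  have hNR : (2 : ℝ) ≤ N := by exact_mod_cast hN
  set L : ℝ := Real.logb 2 (4 / 3) with hL
  set l : ℝ := Real.logb 2 N with hl
  have hL0 : 0 < L := Real.logb_pos (by norm_num) (by norm_num)
  have hL1 : L ≤ 1 := by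
    rw [hL, Real.logb_le_iff_le_rpow (by norm_num) (by norm_num)]; norm_num
  have h2L : (2 : ℝ) ^ L = 4 / 3 := Real.rpow_logb (by norm_num) (by norm_num) (by norm_num)
  have hl1 : 1 ≤ l := by
    rw [hl, Real.le_logb_iff_rpow_le (by norm_num) (by linarith)]; simpa using hNR
  have h2l : (2 : ℝ) ^ l = N := Real.rpow_logb (by norm_num) (by norm_num) (by linarith)
  set E : ℝ := √(2 * l / L) with hE
  have hE2 : L * E ^ 2 = 2 * l := by
    rw [hE, Real.sq_sqrt (by positivity)]; field_simp
  have hlE : l ≤ E ^ 2 := by nlinarith [sq_nonneg E]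
  have hE0 : 0 ≤ E := Real.sqrt_nonneg _
  have hE1 : 1 ≤ E := by nlinarith
  have hLE : √(2 * L) * √l = L * E := by
    rw [← Real.sqrt_mul (by positivity), show 2 * L * l = (L * E) ^ 2 by rw [mul_pow]; nlinarith]
    exact Real.sqrt_sq (by positivity)
  set D : ℕ := ⌊E⌋₊ with hDdef
  have hD : 0 < D := Nat.floor_pos.2 hE1
  have hDR : (1 : ℝ) ≤ D := by exact_mod_cast hD
  have hDE : (D : ℝ) ≤ E := Nat.floor_le hE0
  have hED : E < D + 1 := Nat.lt_floor_add_one E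
  have hD0 : (0 : ℝ) < D := by linarith
  have hNpow : (N : ℝ) ^ (2 / D : ℝ) = 2 ^ (L * E ^ 2 / D) := by
    rw [← h2l, ← Real.rpow_mul (by norm_num), hE2]; ring_nf
  have hDN : √D ≤ (N : ℝ) ^ (2 / D : ℝ) := by
    calc √(D : ℝ) ≤ 1 + D * (1 / 3) := by
          rw [Real.sqrt_le_left (by positivity)]
          nlinarith [sq_nonneg ((D : ℝ) - 1)]
      _ ≤ (1 + 1 / 3) ^ D := one_add_mul_le_pow (by norm_num) D
      _ = 2 ^ (L * D) := by
          rw [Real.rpow_mul (by norm_num), h2L, Real.rpow_natCast]; norm_num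
      _ ≤ 2 ^ (L * E ^ 2 / D) := by
          refine Real.rpow_le_rpow_of_exponent_le (by norm_num) ?_
          rw [le_div_iff₀ hD0]
          nlinarith [mul_le_mul hDE hDE hD0.le hE0]
      _ = _ := hNpow.symm
  obtain ⟨A, hbox, hfree, hcard⟩ := exists_cornerFree_of_dimension hD (by omega) hDN
  refine ⟨A, hbox, hfree, le_trans ?_ hcard⟩
  have hroot : 1 / 2 * l ^ ((1 : ℝ) / 4) ≤ √D := by
    have h1 : l ^ ((1 : ℝ) / 4) ≤ √E := by
      rw [show (1 : ℝ) / 4 = 1 / 2 * (1 / 2) by norm_num, Real.rpow_mul (by linarith),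
        ← Real.sqrt_eq_rpow, ← Real.sqrt_eq_rpow]
      exact Real.sqrt_le_sqrt (Real.sqrt_le_iff.2 ⟨hE0, hlE⟩)
    have h2 : √E ≤ 2 * √D := by
      rw [Real.sqrt_le_left (by positivity), mul_pow, Real.sq_sqrt hD0.le]
      linarith
    linarith
  have hexp : 3 / 4 / 2 ^ (2 * √(2 * L) * √l) ≤ (3 / 4 : ℝ) ^ D / (N : ℝ) ^ (2 / D : ℝ) := by
    have h34 : (3 / 4 : ℝ) = 2 ^ (-L) := by rw [Real.rpow_neg (by norm_num), h2L]; norm_num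
    rw [hNpow, mul_assoc, hLE, h34, ← Real.rpow_natCast, ← Real.rpow_mul (by norm_num),
      ← Real.rpow_sub (by norm_num), ← Real.rpow_sub (by norm_num)]
    refine Real.rpow_le_rpow_of_exponent_le (by norm_num) ?_
    have hdiv : L * E ^ 2 / D ≤ L * (2 * E + 1 - D) := by
      rw [div_le_iff₀ hD0, mul_assoc]
      gcongr
      nlinarith
    linarith
  calc 1 / 20000 * (3 / 8) * l ^ ((1 : ℝ) / 4) * (N : ℝ) ^ 2 / 2 ^ (2 * √(2 * L) * √l)
      = 1 / 20000 * (1 / 2 * l ^ ((1 : ℝ) / 4)) * (N : ℝ) ^ 2 *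
          (3 / 4 / 2 ^ (2 * √(2 * L) * √l)) := by ring
    _ ≤ 1 / 20000 * √D * (N : ℝ) ^ 2 * ((3 / 4 : ℝ) ^ D / (N : ℝ) ^ (2 / D : ℝ)) := by
        gcongr
    _ = _ := by ring
end
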